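/- arXiv:1905.09031 — 8 statements merged into one kernel-verified Lean document; each statement's English description precedes it below -/
import Mathlib

section
/- A vector-lattice homomorphism φ : U → ℝ satisfies φ(𝟏) > 0 if and only if there exist a point t ∈ ℍ and a real number c with 0 < c < ∞ such that φ(f) = c·f(t) for every f ∈ U. -/
open Filter Topology

/-- `Hl` is the half-line `[1, ∞)` with the metric inherited from `ℝ`. -/
abbrev Hl : Type := Set.Ici (1 : ℝ)

/-- `φ` is a vector-lattice homomorphism on the lattice `U` of uniformly continuous
real-valued functions on the half-line: it is additive, homogeneous and preserves
binary suprema on uniformly continuous functions.  (The value of `φ` outside `U` is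
irrelevant: all hypotheses and conclusions only involve uniformly continuous
functions.) -/
def IsLatticeHom (φ : (Hl → ℝ) → ℝ) : Prop :=
  (∀ f g : Hl → ℝ, UniformContinuous f → UniformContinuous g →
      φ (f + g) = φ f + φ g) ∧
  (∀ (c : ℝ) (f : Hl → ℝ), UniformContinuous f → φ (c • f) = c * φ f) ∧
  (∀ f g : Hl → ℝ, UniformContinuous f → UniformContinuous g →
      φ (f ⊔ g) = max (φ f) (φ g))

/-- On the half-line, a bound on the oscillation of `f` at scale `δ` propagates to scale `n * δ`. -/
theorem abs_sub_le_nat_mul_of_osc {f : Hl → ℝ} {ε δ : ℝ}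
    (h : ∀ x y : Hl, |(x : ℝ) - y| ≤ δ → |f x - f y| ≤ ε) (n : ℕ) (x y : Hl)
    (hxy : |(x : ℝ) - y| ≤ n * δ) : |f x - f y| ≤ n * ε := by
  induction n generalizing x with
  | zero =>
    have hx : x = y := by
      ext
      simpa [sub_eq_zero] using hxy
    simp [hx]
  | succ n ih =>
    push_cast at hxy ⊢
    have hn : (0 : ℝ) < n + 1 := by positivity
    set d : ℝ := ((x : ℝ) - y) / (n + 1) with hd
    have hdx : (x : ℝ) - y = (n + 1) * d := by rw [hd]; field_simp
    have hdδ : |d| ≤ δ := by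
      rw [hdx, abs_mul, abs_of_pos hn] at hxy
      exact le_of_mul_le_mul_left hxy hn
    have hx1 : (1 : ℝ) ≤ x := x.2
    have hy1 : (1 : ℝ) ≤ y := y.2
    have hz : (1 : ℝ) ≤ y + n * d := by
      rcases le_total 0 d with h0 | h0
      · have : 0 ≤ (n : ℝ) * d := by positivity
        linarith
      · linarith
    have hxz : |f x - f ⟨y + n * d, hz⟩| ≤ ε := by
      refine h _ _ ?_
      have : (x : ℝ) - (y + n * d) = d := by linarith
      simpa only [this] using hdδ
    have hzy := ih ⟨y + n * d, hz⟩ (by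
      have : (y : ℝ) + n * d - y = n * d := by ring
      simp only [this, abs_mul, Nat.abs_cast]
      gcongr)
    linarith [abs_sub_le (f x) (f ⟨y + n * d, hz⟩) (f y)]

/-- A uniformly continuous function on the half-line is Lipschitz up to an arbitrarily small
additive error. -/
theorem UniformContinuous.exists_abs_sub_le_add_mul {f : Hl → ℝ} (hf : UniformContinuous f)
    {ε : ℝ} (hε : 0 < ε) : ∃ K : ℝ, ∀ x y : Hl, |f x - f y| ≤ ε + K * |(x : ℝ) - y| := by
  obtain ⟨δ, hδ, h⟩ := Metric.uniformContinuous_iff.1 hf ε hε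
  have hosc : ∀ x y : Hl, |(x : ℝ) - y| ≤ δ / 2 → |f x - f y| ≤ ε := by
    intro x y hxy
    have hlt : dist x y < δ := by
      rw [Subtype.dist_eq, Real.dist_eq]
      linarith
    exact (h hlt).le
  refine ⟨ε / (δ / 2), fun x y => ?_⟩
  set r : ℝ := |(x : ℝ) - y| / (δ / 2) with hr
  have hr0 : 0 ≤ r := by positivity
  have hxy : |(x : ℝ) - y| = r * (δ / 2) := by rw [hr]; field_simp
  have hn := abs_sub_le_nat_mul_of_osc hosc (⌈r⌉₊) x y (by
    rw [hxy]
    gcongr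
    exact Nat.le_ceil r)
  calc |f x - f y| ≤ ⌈r⌉₊ * ε := hn
    _ ≤ (r + 1) * ε := by
      gcongr
      exact (Nat.ceil_lt_add_one hr0).le
    _ = ε + ε / (δ / 2) * |(x : ℝ) - y| := by rw [hr]; ring

namespace IsLatticeHom

variable {φ : (Hl → ℝ) → ℝ} {f g : Hl → ℝ}

theorem mono (hφ : IsLatticeHom φ) (hf : UniformContinuous f) (hg : UniformContinuous g)
    (hfg : f ≤ g) : φ f ≤ φ g := by
  have h := hφ.2.2 f g hf hg
  rw [sup_eq_right.2 hfg] at h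
  exact h ▸ le_max_left _ _

theorem map_const (hφ : IsLatticeHom φ) (a : ℝ) : φ (fun _ => a) = a * φ (fun _ => 1) := by
  rw [← hφ.2.1 a _ uniformContinuous_const]
  congr 1
  ext
  simp

theorem map_abs_sub_const (hφ : IsLatticeHom φ) (hf : UniformContinuous f) (a : ℝ) :
    φ (fun x => |f x - a|) = |φ f - a * φ (fun _ => 1)| := by
  have hu : UniformContinuous (f + fun _ => -a) := hf.add uniformContinuous_const
  have hv : UniformContinuous ((-1 : ℝ) • (f + fun _ => -a)) := hu.const_smul _
  have heq : (fun x => |f x - a|) = (f + fun _ => -a) ⊔ ((-1 : ℝ) • (f + fun _ => -a)) := by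
    ext x
    simp only [Pi.sup_apply, Pi.add_apply, Pi.smul_apply, smul_eq_mul, neg_one_mul,
      ← sub_eq_add_neg]
    rfl
  rw [heq, hφ.2.2 _ _ hu hv, hφ.2.1 _ _ hu, hφ.1 _ _ hf uniformContinuous_const,
    hφ.map_const, neg_one_mul, neg_mul, ← sub_eq_add_neg]
  rfl

end IsLatticeHom

/-- A vector-lattice homomorphism `φ : U → ℝ` satisfies `φ(𝟏) > 0` if and only if it
has the form `φ(f) = c * f(t)` for some point `t` of the half-line and some
`0 < c < ∞`. -/
theorem hom_positive_at_one_iff_evaluation (φ : (Hl → ℝ) → ℝ) (hφ : IsLatticeHom φ) :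
    0 < φ (fun _ => (1 : ℝ)) ↔
      ∃ (t : Hl) (c : ℝ), 0 < c ∧ ∀ f : Hl → ℝ, UniformContinuous f → φ f = c * f t := by
  constructor
  · intro hc
    set c := φ (fun _ => (1 : ℝ)) with hc_def
    have hι : UniformContinuous (Subtype.val : Hl → ℝ) := uniformContinuous_subtype_val
    have hT : 1 ≤ φ Subtype.val / c := by
      rw [one_le_div hc]
      exact hφ.mono uniformContinuous_const hι fun x => x.2
    set t : Hl := ⟨φ Subtype.val / c, hT⟩ with ht
    have hdist : φ (fun x : Hl => |(x : ℝ) - t|) = 0 := by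
      rw [hφ.map_abs_sub_const hι, ← hc_def, ht, div_mul_cancel₀ _ hc.ne', sub_self, abs_zero]
    refine ⟨t, c, hc, fun f hf => ?_⟩
    have hbound : ∀ ε : ℝ, 0 < ε → |φ f - f t * c| ≤ ε * c := by
      intro ε hε
      obtain ⟨K, hK⟩ := hf.exists_abs_sub_le_add_mul hε
      have hd : UniformContinuous fun x : Hl => |(x : ℝ) - t| :=
        uniformContinuous_norm.comp (hι.sub uniformContinuous_const)
      have hKd : UniformContinuous (K • fun x : Hl => |(x : ℝ) - t|) := hd.const_smul K
      have hle : φ (fun x => |f x - f t|) ≤ φ ((fun _ => ε) + K • fun x : Hl => |(x : ℝ) - t|) :=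
        hφ.mono
          (uniformContinuous_norm.comp (hf.sub uniformContinuous_const))
          (uniformContinuous_const.add hKd) fun x => hK x t
      calc |φ f - f t * c| = φ (fun x => |f x - f t|) := (hφ.map_abs_sub_const hf _).symm
        _ ≤ φ ((fun _ => ε) + K • fun x : Hl => |(x : ℝ) - t|) := hle
        _ = ε * c := by
          rw [hφ.1 _ _ uniformContinuous_const hKd, hφ.2.1 _ _ hd, hdist, hφ.map_const,
            mul_zero, add_zero]
    have hzero : |φ f - f t * c| ≤ 0 := by
      refine le_of_forall_pos_le_add fun η hη => ?_
      have := hbound (η / c) (div_pos hη hc)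
      rwa [div_mul_cancel₀ _ hc.ne', ← zero_add η] at this
    rw [mul_comm]
    exact sub_eq_zero.1 (abs_nonpos_iff.1 hzero)
  · rintro ⟨t, c, hc, h⟩
    rw [h _ uniformContinuous_const, mul_one]
    exact hc
end

section
/- For every free ultrafilter 𝒰 on the positive integers, the formula φ_𝒰(f) = lim_{𝒰(n)} f(n)/n is well defined on U (the limit along 𝒰 exists because the sequence f(n)/n is bounded for f ∈ U), and φ_𝒰 is a vector-lattice homomorphism U → ℝ that vanishes on every bounded function in U and satisfies φ_𝒰(𝔱) = 1. -/
open Filter Topology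

/-- The point of the half-line corresponding to a positive integer. -/
def toH (n : ℕ+) : Hl := ⟨((n : ℕ) : ℝ), Set.mem_Ici.mpr (by exact_mod_cast n.one_le)⟩

/-- A uniformly continuous function on the half-line grows at most linearly along the
positive integers. -/
lemma exists_abs_toH_div_le {f : Hl → ℝ} (hf : UniformContinuous f) :
    ∃ C : ℝ, ∀ n : ℕ+, |f (toH n) / ((n : ℕ) : ℝ)| ≤ C := by
  obtain ⟨δ, hδ, h⟩ := Metric.uniformContinuous_iff.1 hf 1 one_pos
  obtain ⟨m, hm⟩ := exists_nat_one_div_lt hδ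
  set d : ℝ := 1 / ((m : ℝ) + 1) with hd
  have hd0 : 0 < d := by positivity
  have mem : ∀ k : ℕ, 1 + k * d ∈ Set.Ici (1 : ℝ) := fun k => by
    have : 0 ≤ k * d := by positivity
    exact Set.mem_Ici.2 (by linarith)
  have key : ∀ k : ℕ, |f ⟨1 + k * d, mem k⟩| ≤ |f (toH 1)| + k := by
    intro k
    induction k with
    | zero => simp [toH]
    | succ k ih =>
      have hstep : dist (f ⟨1 + (k + 1 : ℕ) * d, mem (k + 1)⟩) (f ⟨1 + k * d, mem k⟩) < 1 := by
        apply h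
        rw [Subtype.dist_eq, Real.dist_eq]
        have : 1 + ((k + 1 : ℕ) : ℝ) * d - (1 + k * d) = d := by push_cast; ring
        rwa [this, abs_of_pos hd0]
      rw [Real.dist_eq] at hstep
      have := abs_sub_abs_le_abs_sub (f ⟨1 + (k + 1 : ℕ) * d, mem (k + 1)⟩) (f ⟨1 + k * d, mem k⟩)
      push_cast at *
      linarith
  refine ⟨|f (toH 1)| + (m + 1), fun n => ?_⟩
  have hn : (1 : ℝ) ≤ (n : ℕ) := by exact_mod_cast n.pos
  have hcast : (((n : ℕ) - 1 : ℕ) : ℝ) = (n : ℕ) - 1 := by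
    rw [Nat.cast_sub (Nat.succ_le_of_lt n.pos), Nat.cast_one]
  have hpt : (⟨1 + (((n : ℕ) - 1) * (m + 1) : ℕ) * d, mem _⟩ : Hl) = toH n := by
    apply Subtype.ext
    simp only [toH, Nat.cast_mul, hcast, hd]
    push_cast
    field_simp
    ring
  have hb := key (((n : ℕ) - 1) * (m + 1))
  rw [hpt, Nat.cast_mul, hcast] at hb
  push_cast at hb
  rw [abs_div, abs_of_pos (by linarith : (0 : ℝ) < (n : ℕ)), div_le_iff₀ (by linarith)]
  have := abs_nonneg (f (toH 1))
  have hm0 : (0 : ℝ) ≤ m := m.cast_nonneg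
  nlinarith

/-- A bounded real function converges along every ultrafilter. -/
lemma Ultrafilter.exists_tendsto_of_abs_le {α : Type*} (𝒰 : Ultrafilter α) {u : α → ℝ} {C : ℝ}
    (hu : ∀ a, |u a| ≤ C) : ∃ x, Tendsto u 𝒰 (𝓝 x) := by
  obtain ⟨x, -, hx⟩ := (isCompact_Icc (a := -C) (b := C)).ultrafilter_le_nhds (𝒰.map u)
    (tendsto_principal.2 (Eventually.of_forall fun a => abs_le.1 (hu a)))
  exact ⟨x, hx⟩

/-- For every free ultrafilter `𝒰` on the positive integers, the formula
`φ_𝒰(f) = lim_{𝒰(n)} f(n)/n` is well defined on `U` (the limit along `𝒰` exists),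
and `φ_𝒰` is a vector-lattice homomorphism `U → ℝ` that vanishes on every bounded
function of `U` and sends the identity function `𝔱` to `1`. -/
theorem ultrafilter_induces_hom (𝒰 : Ultrafilter ℕ+) (hfree : ∀ n : ℕ+, 𝒰 ≠ pure n) :
    ∃ φ : (Hl → ℝ) → ℝ, IsLatticeHom φ ∧
      (∀ f : Hl → ℝ, UniformContinuous f →
        Tendsto (fun n : ℕ+ => f (toH n) / ((n : ℕ) : ℝ)) ↑𝒰 (𝓝 (φ f))) ∧
      (∀ g : Hl → ℝ, UniformContinuous g → (∃ M : ℝ, ∀ t : Hl, |g t| ≤ M) → φ g = 0) ∧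
      φ (fun t : Hl => (t : ℝ)) = 1 := by
  have hlim : ∀ f : Hl → ℝ, UniformContinuous f →
      Tendsto (fun n : ℕ+ => f (toH n) / ((n : ℕ) : ℝ)) 𝒰
        (𝓝 (limUnder 𝒰 fun n : ℕ+ => f (toH n) / ((n : ℕ) : ℝ))) := fun f hf =>
    let ⟨_, hC⟩ := exists_abs_toH_div_le hf
    tendsto_nhds_limUnder (𝒰.exists_tendsto_of_abs_le hC)
  have hcof : (𝒰 : Filter ℕ+) ≤ cofinite :=
    𝒰.le_cofinite_or_eq_pure.resolve_right fun ⟨n, hn⟩ => hfree n hn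
  have hcast : Tendsto (fun n : ℕ+ => ((n : ℕ) : ℝ)) 𝒰 atTop :=
    tendsto_natCast_atTop_atTop.comp
      ((Nat.cofinite_eq_atTop ▸ PNat.coe_injective.tendsto_cofinite).mono_left hcof)
  refine ⟨fun f => limUnder 𝒰 fun n : ℕ+ => f (toH n) / ((n : ℕ) : ℝ), ⟨?_, ?_, ?_⟩, hlim, ?_, ?_⟩
  · intro f g hf hg
    refine (((hlim f hf).add (hlim g hg)).congr fun n => ?_).limUnder_eq
    simp [add_div]
  · intro c f hf
    refine (((hlim f hf).const_mul c).congr fun n => ?_).limUnder_eq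
    simp [mul_div_assoc]
  · intro f g hf hg
    refine (((hlim f hf).max (hlim g hg)).congr fun n => ?_).limUnder_eq
    exact max_div_div_right (Nat.cast_nonneg _) _ _
  · rintro g - ⟨M, hM⟩
    refine Tendsto.limUnder_eq ?_
    refine squeeze_zero_norm (fun n => ?_) (hcast.const_div_atTop M)
    rw [norm_div, Real.norm_eq_abs, Real.norm_natCast]
    gcongr
    exact hM _
  · refine (tendsto_const_nhds.congr fun n : ℕ+ => ?_).limUnder_eq
    exact (div_self (Nat.cast_ne_zero.2 n.ne_zero)).symm
end

section
/- Shift invariance: for every uniformly continuous f : ℍ → ℝ and every free ultrafilter 𝒰 on the positive integers, lim_{𝒰(n)} f(n+1)/(n+1) = lim_{𝒰(n)} f(n)/n; that is, the homomorphisms φ_𝒰 and φ_{1+𝒰} induced by 𝒰 and its translate 1+𝒰 coincide on U, even though 𝒰 ≠ 1+𝒰 as ultrafilters. -/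
open Filter Topology

/-- A uniformly continuous function on the half-line changes by a bounded amount over
unit steps between consecutive integers. -/
theorem exists_abs_sub_succ_le (f : Hl → ℝ) (hf : UniformContinuous f) :
    ∃ M : ℝ, 0 ≤ M ∧ ∀ n : ℕ+, |f (toH (n + 1)) - f (toH n)| ≤ M := by
  obtain ⟨δ, hδ, h⟩ := Metric.uniformContinuous_iff.mp hf 1 one_pos
  obtain ⟨m, hm⟩ := exists_nat_one_div_lt hδ
  have hm0 : (0 : ℝ) < (m : ℝ) + 1 := by positivity
  refine ⟨(m : ℝ) + 1, hm0.le, fun n => ?_⟩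
  have hmem : ∀ k : ℕ, ((n : ℕ) : ℝ) + k / ((m : ℝ) + 1) ∈ Set.Ici (1 : ℝ) := fun k => by
    have h1 : (1 : ℝ) ≤ ((n : ℕ) : ℝ) := by exact_mod_cast n.pos
    have h2 : (0 : ℝ) ≤ k / ((m : ℝ) + 1) := by positivity
    exact Set.mem_Ici.mpr (by linarith)
  have key : ∀ k : ℕ, |f ⟨_, hmem k⟩ - f (toH n)| ≤ k := by
    intro k
    induction k with
    | zero =>
      have : (⟨_, hmem 0⟩ : Hl) = toH n := Subtype.ext (by simp [toH])
      rw [this]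
      simp
    | succ k ih =>
      have hd : dist (⟨_, hmem (k + 1)⟩ : Hl) ⟨_, hmem k⟩ < δ := by
        rw [Subtype.dist_eq, Real.dist_eq]
        have : ((n : ℕ) : ℝ) + ((k + 1 : ℕ) : ℝ) / ((m : ℝ) + 1)
            - (((n : ℕ) : ℝ) + k / ((m : ℝ) + 1)) = 1 / ((m : ℝ) + 1) := by
          push_cast
          ring
        rw [this, abs_of_pos (by positivity)]
        exact hm
      have h1 := h hd
      rw [Real.dist_eq] at h1
      have h2 := abs_sub_le (f ⟨_, hmem (k + 1)⟩) (f ⟨_, hmem k⟩) (f (toH n))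
      push_cast at *
      linarith
  have hlast : (⟨_, hmem (m + 1)⟩ : Hl) = toH (n + 1) := Subtype.ext (by
    simp only [toH, PNat.add_coe, PNat.one_coe, Nat.cast_add, Nat.cast_one]
    rw [div_self hm0.ne'])
  have hkey := key (m + 1)
  rw [hlast] at hkey
  exact_mod_cast hkey

/-- A function on the half-line with bounded increments over consecutive integers grows at
most linearly along the integers. -/
theorem abs_le_mul_of_abs_sub_succ_le (f : Hl → ℝ) {M : ℝ} (hM0 : 0 ≤ M)
    (hM : ∀ n : ℕ+, |f (toH (n + 1)) - f (toH n)| ≤ M) (n : ℕ+) :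
    |f (toH n)| ≤ (|f (toH 1)| + M) * ((n : ℕ) : ℝ) := by
  induction n using PNat.recOn with
  | one => simpa using hM0
  | succ n ih =>
    have h1 := hM n
    have h2 := abs_sub_abs_le_abs_sub (f (toH (n + 1))) (f (toH n))
    have h3 := abs_nonneg (f (toH 1))
    push_cast
    linarith

/-- The difference of `f(n+1)/(n+1)` and `f(n)/n` vanishes at infinity. -/
theorem tendsto_div_succ_sub_div (f : Hl → ℝ) (hf : UniformContinuous f) :
    Tendsto (fun n : ℕ+ => f (toH (n + 1)) / (((n + 1 : ℕ+) : ℕ) : ℝ)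
      - f (toH n) / ((n : ℕ) : ℝ)) cofinite (𝓝 0) := by
  obtain ⟨M, hM0, hM⟩ := exists_abs_sub_succ_le f hf
  have hcast : Tendsto (fun n : ℕ+ => ((n : ℕ) : ℝ)) cofinite atTop :=
    tendsto_natCast_atTop_atTop.comp
      (Nat.cofinite_eq_atTop ▸ PNat.coe_injective.tendsto_cofinite)
  refine squeeze_zero_norm (fun n => ?_) (hcast.const_div_atTop (|f (toH 1)| + 2 * M))
  have hn : (0 : ℝ) < ((n : ℕ) : ℝ) := by exact_mod_cast n.pos
  have hlin := abs_le_mul_of_abs_sub_succ_le f hM0 hM n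
  have hdiff : f (toH (n + 1)) / (((n + 1 : ℕ+) : ℕ) : ℝ) - f (toH n) / ((n : ℕ) : ℝ)
      = ((f (toH (n + 1)) - f (toH n)) - f (toH n) / ((n : ℕ) : ℝ))
        / (((n : ℕ) : ℝ) + 1) := by
    push_cast
    field_simp
    ring
  have hquot : |f (toH n) / ((n : ℕ) : ℝ)| ≤ |f (toH 1)| + M := by
    rw [abs_div, abs_of_pos hn]
    exact (div_le_iff₀ hn).mpr hlin
  have hnum := abs_sub (f (toH (n + 1)) - f (toH n)) (f (toH n) / ((n : ℕ) : ℝ))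
  rw [hdiff, Real.norm_eq_abs, abs_div, abs_of_pos (by linarith : (0 : ℝ) < ((n : ℕ) : ℝ) + 1)]
  have := hM n
  exact div_le_div₀ (by positivity) (by linarith) hn (by linarith)

/-- No ultrafilter on the positive integers is invariant under translation by one. -/
theorem ultrafilter_map_add_one_ne (𝒰 : Ultrafilter ℕ+) :
    Ultrafilter.map (fun n : ℕ+ => n + 1) 𝒰 ≠ 𝒰 := by
  intro h
  have hpre : (fun n : ℕ+ => n + 1) ⁻¹' {n : ℕ+ | Even (n : ℕ)} = {n : ℕ+ | Even (n : ℕ)}ᶜ := by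
    ext n
    simp [Nat.even_add_one]
  have hiff : {n : ℕ+ | Even (n : ℕ)} ∈ 𝒰 ↔ {n : ℕ+ | Even (n : ℕ)}ᶜ ∈ 𝒰 := by
    rw [← hpre, ← Ultrafilter.mem_map, h]
  rw [Ultrafilter.compl_mem_iff_notMem] at hiff
  tauto

/-- Shift invariance: for every uniformly continuous `f` on the half-line and every
free ultrafilter `𝒰` on the positive integers, `lim_{𝒰(n)} f(n+1)/(n+1)` equals
`lim_{𝒰(n)} f(n)/n`; equivalently the homomorphisms induced by `𝒰` and its translate
`1 + 𝒰 = (n ↦ n+1)[𝒰]` coincide, even though `1 + 𝒰 ≠ 𝒰` as ultrafilters. -/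
theorem shift_invariance (f : Hl → ℝ) (hf : UniformContinuous f)
    (𝒰 : Ultrafilter ℕ+) (hfree : ∀ n : ℕ+, 𝒰 ≠ pure n) :
    (∀ ℓ : ℝ,
      Tendsto (fun n : ℕ+ => f (toH (n + 1)) / (((n + 1 : ℕ+) : ℕ) : ℝ)) ↑𝒰 (𝓝 ℓ) ↔
      Tendsto (fun n : ℕ+ => f (toH n) / ((n : ℕ) : ℝ)) ↑𝒰 (𝓝 ℓ)) ∧
    (∀ ℓ : ℝ,
      Tendsto (fun n : ℕ+ => f (toH n) / ((n : ℕ) : ℝ))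
        ↑(Ultrafilter.map (fun n : ℕ+ => n + 1) 𝒰) (𝓝 ℓ) ↔
      Tendsto (fun n : ℕ+ => f (toH n) / ((n : ℕ) : ℝ)) ↑𝒰 (𝓝 ℓ)) ∧
    Ultrafilter.map (fun n : ℕ+ => n + 1) 𝒰 ≠ 𝒰 := by
  have hle : (𝒰 : Filter ℕ+) ≤ cofinite :=
    𝒰.le_cofinite_or_eq_pure.resolve_right fun ⟨n, hn⟩ => hfree n hn
  have hdiff := (tendsto_div_succ_sub_div f hf).mono_left hle
  have hiff : ∀ ℓ : ℝ,
      Tendsto (fun n : ℕ+ => f (toH (n + 1)) / (((n + 1 : ℕ+) : ℕ) : ℝ)) ↑𝒰 (𝓝 ℓ) ↔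
      Tendsto (fun n : ℕ+ => f (toH n) / ((n : ℕ) : ℝ)) ↑𝒰 (𝓝 ℓ) := fun ℓ =>
    ⟨fun h => by simpa using h.sub hdiff, fun h => by simpa using h.add hdiff⟩
  refine ⟨hiff, fun ℓ => ?_, ultrafilter_map_add_one_ne 𝒰⟩
  rw [← hiff ℓ, Ultrafilter.coe_map, tendsto_map'_iff]
  rfl
end

section
/- For every subset A of the nonnegative integers there exists a Lipschitz function f : ℍ → ℝ with Lipschitz constant at most 2 such that f(2^n) = 2^n for every n ∈ A and f(2^n) = 0 for every nonnegative integer n ∉ A (namely, the piecewise-linear interpolation of these values at the dyadic points 2^n). -/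
open Filter Topology

/-- The dyadic point `2 ^ n` of the half-line. -/
def pow2 (n : ℕ) : Hl := ⟨2 ^ n, Set.mem_Ici.mpr (one_le_pow₀ one_le_two)⟩

theorem abs_sub_le_two_mul_of_dyadic {m n : ℕ} {a b : ℝ} (ha : a = 0 ∨ a = 2 ^ m)
    (hb : b = 0 ∨ b = 2 ^ n) (hmn : m < n) : |a - b| ≤ 2 * |(2 : ℝ) ^ m - 2 ^ n| := by
  have hm : (0 : ℝ) < 2 ^ m := by positivity
  have hle : (2 : ℝ) * 2 ^ m ≤ 2 ^ n := by
    rw [← pow_succ']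
    exact pow_le_pow_right₀ one_le_two hmn
  rw [abs_of_neg (show (2 : ℝ) ^ m - 2 ^ n < 0 by linarith), abs_le]
  rcases ha with rfl | rfl <;> rcases hb with rfl | rfl <;> constructor <;> linarith

theorem pow2_injective : Function.Injective pow2 := fun _ _ h =>
  pow_right_injective₀ (zero_lt_two (α := ℝ)) (by norm_num) (congrArg Subtype.val h)

/-- For every set `A` of nonnegative integers there is a Lipschitz function on the
half-line, with Lipschitz constant at most `2`, taking the value `2 ^ n` at `2 ^ n`
for `n ∈ A` and the value `0` at `2 ^ n` for `n ∉ A`. -/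
theorem dyadic_interpolation (A : Set ℕ) :
    ∃ f : Hl → ℝ, LipschitzWith 2 f ∧
      (∀ n ∈ A, f (pow2 n) = 2 ^ n) ∧
      (∀ n : ℕ, n ∉ A → f (pow2 n) = 0) := by
  classical
  let v : ℕ → ℝ := fun n => if n ∈ A then 2 ^ n else 0
  have hv (n : ℕ) : v n = 0 ∨ v n = 2 ^ n := by
    by_cases hn : n ∈ A <;> simp [v, hn]
  let g : Hl → ℝ := Function.extend pow2 v 0
  have hg (n : ℕ) : g (pow2 n) = v n := pow2_injective.extend_apply v 0 n
  have hlip : LipschitzOnWith 2 g (Set.range pow2) := by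
    refine LipschitzOnWith.of_dist_le_mul ?_
    rintro _ ⟨m, rfl⟩ _ ⟨n, rfl⟩
    rw [hg, hg, Subtype.dist_eq, Real.dist_eq, Real.dist_eq]
    change |v m - v n| ≤ 2 * |(2 : ℝ) ^ m - 2 ^ n|
    rcases lt_trichotomy m n with h | rfl | h
    · exact abs_sub_le_two_mul_of_dyadic (hv m) (hv n) h
    · simp
    · rw [abs_sub_comm, abs_sub_comm ((2 : ℝ) ^ m)]
      exact abs_sub_le_two_mul_of_dyadic (hv n) (hv m) h
  obtain ⟨f, hf, hfg⟩ := hlip.extend_real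
  have hfv (n : ℕ) : f (pow2 n) = v n := (hfg ⟨n, rfl⟩).symm.trans (hg n)
  exact ⟨f, hf, fun n hn => by simp [hfv, v, hn], fun n hn => by simp [hfv, v, hn]⟩
end

section
/- Separation by the exponential map: if 𝒰 and 𝒱 are two distinct free ultrafilters on the nonnegative integers, then there exists a Lipschitz (hence uniformly continuous) function f : ℍ → ℝ such that lim_{𝒰(n)} f(2^n)/2^n = 1 and lim_{𝒱(n)} f(2^n)/2^n = 0. In particular the homomorphisms on U induced by the image ultrafilters 2^•[𝒰] and 2^•[𝒱] are distinct. -/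
open Filter Topology

theorem two_pow_le_two_mul_dist_pow2 {m n : ℕ} (h : m < n) :
    (2 : ℝ) ^ n ≤ 2 * dist (pow2 m) (pow2 n) := by
  have hle : (2 : ℝ) ^ (m + 1) ≤ 2 ^ n := pow_le_pow_right₀ one_le_two h
  have hdist : dist (pow2 m) (pow2 n) = |(2 : ℝ) ^ m - 2 ^ n| := rfl
  rw [hdist, abs_sub_comm]
  rw [pow_succ] at hle
  linarith [le_abs_self ((2 : ℝ) ^ n - 2 ^ m)]

/-- The inclusion of the half-line in `ℝ`, cut off outside the dyadic points with exponent
in `A`, is `2`-Lipschitz on the set of dyadic points. -/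
theorem lipschitzOnWith_indicator_pow2 (A : Set ℕ) :
    LipschitzOnWith 2 ((pow2 '' A).indicator fun x : Hl => (x : ℝ)) (Set.range pow2) := by
  set g : Hl → ℝ := (pow2 '' A).indicator fun x : Hl => (x : ℝ)
  have hnonneg (n : ℕ) : 0 ≤ g (pow2 n) :=
    Set.indicator_nonneg (fun x _ => zero_le_one.trans x.2) _
  have hle (n : ℕ) : g (pow2 n) ≤ 2 ^ n :=
    Set.indicator_le_self' (fun x _ => zero_le_one.trans x.2) _
  have hlt {m n : ℕ} (h : m < n) : dist (g (pow2 m)) (g (pow2 n)) ≤ 2 * dist (pow2 m) (pow2 n) := by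
    refine le_trans ?_ (two_pow_le_two_mul_dist_pow2 h)
    have hmn : (2 : ℝ) ^ m ≤ 2 ^ n := pow_le_pow_right₀ one_le_two h.le
    rw [Real.dist_eq, abs_le]
    constructor <;> linarith [hnonneg m, hnonneg n, hle m, hle n]
  refine LipschitzOnWith.of_dist_le_mul ?_
  rintro _ ⟨m, rfl⟩ _ ⟨n, rfl⟩
  rcases lt_trichotomy m n with h | rfl | h
  · exact hlt h
  · simp
  · rw [dist_comm, dist_comm (pow2 m)]
    exact hlt h

/-- Separation by the exponential map: if `𝒰 ≠ 𝒱` are free ultrafilters on the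
nonnegative integers, then there is a Lipschitz (hence uniformly continuous) function
`f` on the half-line with `lim_{𝒰(n)} f(2^n)/2^n = 1` and `lim_{𝒱(n)} f(2^n)/2^n = 0`;
in particular the homomorphisms induced by the image ultrafilters `2^•[𝒰]` and
`2^•[𝒱]` are distinct. -/
theorem exponential_separation (𝒰 𝒱 : Ultrafilter ℕ)
    (h𝒰 : ∀ n : ℕ, 𝒰 ≠ pure n) (h𝒱 : ∀ n : ℕ, 𝒱 ≠ pure n) (hne : 𝒰 ≠ 𝒱) :
    ∃ f : Hl → ℝ, (∃ L : NNReal, LipschitzWith L f) ∧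
      Tendsto (fun n : ℕ => f (pow2 n) / 2 ^ n) ↑𝒰 (𝓝 1) ∧
      Tendsto (fun n : ℕ => f (pow2 n) / 2 ^ n) ↑𝒱 (𝓝 0) := by
  obtain ⟨A, hA𝒰, hA𝒱⟩ : ∃ A ∈ 𝒰, A ∉ 𝒱 := by
    by_contra! h
    exact hne (Ultrafilter.coe_le_coe.mp fun A hA => h A hA).symm
  obtain ⟨f, hf, hfg⟩ := (lipschitzOnWith_indicator_pow2 A).extend_real
  refine ⟨f, ⟨2, hf⟩, ?_, ?_⟩
  · refine tendsto_const_nhds.congr' ?_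
    filter_upwards [hA𝒰] with n hn
    rw [← hfg (Set.mem_range_self n), Set.indicator_of_mem (Set.mem_image_of_mem pow2 hn)]
    exact (div_self (pow_ne_zero n two_ne_zero)).symm
  · refine tendsto_const_nhds.congr' ?_
    filter_upwards [Ultrafilter.compl_mem_iff_notMem.mpr hA𝒱] with n hn
    rw [← hfg (Set.mem_range_self n),
      Set.indicator_of_notMem (fun h => hn (pow2_injective.mem_set_image.mp h)), zero_div]
end

section
/- Every nonzero vector-lattice homomorphism φ : U → ℝ satisfies φ(𝔱) > 0; equivalently, a homomorphism which vanishes at the identity function 𝔱 vanishes identically on U. -/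
open Filter Topology

/-- A uniformly continuous function on `[1, ∞)` is dominated by a multiple of the identity. -/
lemma UniformContinuous.exists_abs_le_mul_id {f : Hl → ℝ} (hf : UniformContinuous f) :
    ∃ C : ℝ, ∀ t : Hl, |f t| ≤ C * t := by
  obtain ⟨δ, hδ, H⟩ := Metric.uniformContinuous_iff.1 hf 1 one_pos
  let e : Hl := ⟨1, le_refl (1 : ℝ)⟩
  have key : ∀ (n : ℕ) (t : Hl), (t : ℝ) - 1 ≤ n * (δ / 2) → |f t - f e| ≤ n := by
    intro n
    induction n with
    | zero =>
      intro t ht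
      have ht1 : (1 : ℝ) ≤ t := t.2
      have ht0 : (t : ℝ) ≤ 1 := by simpa using ht
      have hte : t = e := Subtype.ext (le_antisymm ht0 ht1)
      simp [hte]
    | succ n ih =>
      intro t ht
      have ht1 : (1 : ℝ) ≤ t := t.2
      push_cast at ht ⊢
      let s : Hl := ⟨max 1 (t - δ / 2), le_max_left (1 : ℝ) _⟩
      have hs : (s : ℝ) = max 1 ((t : ℝ) - δ / 2) := rfl
      have h₁ : |f s - f e| ≤ n := by
        refine ih s ?_
        rw [hs, sub_le_iff_le_add]
        refine max_le ?_ (by linarith)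
        have : (0 : ℝ) ≤ n * (δ / 2) := by positivity
        linarith
      have h₂ : |f t - f s| < 1 := by
        refine H ?_
        rw [Subtype.dist_eq, Real.dist_eq, hs, abs_lt]
        refine ⟨?_, ?_⟩
        · have : max 1 ((t : ℝ) - δ / 2) ≤ t := max_le ht1 (by linarith)
          linarith
        · linarith [le_max_right 1 ((t : ℝ) - δ / 2)]
      linarith [abs_sub_le (f t) (f s) (f e)]
  refine ⟨|f e| + 1 + 2 / δ, fun t => ?_⟩
  have ht1 : (1 : ℝ) ≤ t := t.2
  have hpos : 0 ≤ ((t : ℝ) - 1) / (δ / 2) := div_nonneg (by linarith) (by positivity)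
  have h₁ := key ⌈((t : ℝ) - 1) / (δ / 2)⌉₊ t ((div_le_iff₀ (by positivity)).1 (Nat.le_ceil _))
  have h₂ := Nat.ceil_lt_add_one hpos
  have h₃ : ((t : ℝ) - 1) / (δ / 2) = 2 / δ * t - 2 / δ := by
    field_simp
  have h₄ : |f t| ≤ |f t - f e| + |f e| := by simpa using abs_add_le (f t - f e) (f e)
  have h₅ : 0 < 2 / δ := by positivity
  have h₆ : |f e| + 1 ≤ (|f e| + 1) * t := le_mul_of_one_le_right (by positivity) ht1
  linarith

lemma IsLatticeHom.mono_s12 {φ : (Hl → ℝ) → ℝ} (hφ : IsLatticeHom φ) {f g : Hl → ℝ}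
    (hf : UniformContinuous f) (hg : UniformContinuous g) (h : f ≤ g) : φ f ≤ φ g := by
  have := hφ.2.2 f g hf hg
  rw [sup_eq_right.2 h] at this
  exact this ▸ le_max_left _ _

lemma IsLatticeHom.exists_abs_le_mul {φ : (Hl → ℝ) → ℝ} (hφ : IsLatticeHom φ) {f : Hl → ℝ}
    (hf : UniformContinuous f) : ∃ C : ℝ, |φ f| ≤ C * φ (fun t : Hl => (t : ℝ)) := by
  obtain ⟨C, hC⟩ := hf.exists_abs_le_mul_id
  have ht : UniformContinuous (fun t : Hl => (t : ℝ)) := uniformContinuous_subtype_val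
  have hsmul : ∀ (c : ℝ) {g : Hl → ℝ}, UniformContinuous g → UniformContinuous (c • g) :=
    fun c _ hg => hg.const_smul c
  refine ⟨C, abs_le'.2 ⟨?_, ?_⟩⟩
  · rw [← hφ.2.1 C _ ht]
    exact hφ.mono_s12 hf (hsmul C ht) fun t => (abs_le'.1 (hC t)).1
  · rw [← hφ.2.1 C _ ht, ← neg_one_mul, ← hφ.2.1 (-1) f hf]
    refine hφ.mono_s12 (hsmul _ hf) (hsmul C ht) fun t => ?_
    simpa using (abs_le'.1 (hC t)).2

lemma IsLatticeHom.map_id_nonneg {φ : (Hl → ℝ) → ℝ} (hφ : IsLatticeHom φ) :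
    0 ≤ φ (fun t : Hl => (t : ℝ)) := by
  have h0 : UniformContinuous (0 : Hl → ℝ) := uniformContinuous_const
  have hφ0 : φ 0 = 0 := by simpa using hφ.2.1 0 0 h0
  rw [← hφ0]
  exact hφ.mono_s12 h0 uniformContinuous_subtype_val fun t => zero_le_one.trans t.2

/-- Every nonzero vector-lattice homomorphism `φ : U → ℝ` satisfies `φ(𝔱) > 0`;
equivalently, a homomorphism vanishing at the identity function `𝔱` vanishes
identically on `U`. -/
theorem nonzero_hom_positive_at_identity (φ : (Hl → ℝ) → ℝ) (hφ : IsLatticeHom φ) :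
    ((∃ f : Hl → ℝ, UniformContinuous f ∧ φ f ≠ 0) → 0 < φ (fun t : Hl => (t : ℝ))) ∧
    (φ (fun t : Hl => (t : ℝ)) = 0 → ∀ f : Hl → ℝ, UniformContinuous f → φ f = 0) := by
  have vanish : φ (fun t : Hl => (t : ℝ)) = 0 →
      ∀ f : Hl → ℝ, UniformContinuous f → φ f = 0 := by
    intro h f hf
    obtain ⟨C, hC⟩ := hφ.exists_abs_le_mul hf
    simpa [h] using hC
  refine ⟨?_, vanish⟩
  rintro ⟨f, hf, hne⟩
  exact hφ.map_id_nonneg.lt_of_ne fun h => hne (vanish h.symm f hf)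
end

section
/- Injectivity of the parametrization off the boundary: let c, d ∈ [1, 2) with c ≤ d and let 𝒰 ≠ 𝒱 be two distinct free ultrafilters on the nonnegative integers. Then there exists a Lipschitz (hence uniformly continuous) function f : ℍ → ℝ such that lim_{𝒰(n)} f(c·2^n)/(c·2^n) = 1 and lim_{𝒱(n)} f(d·2^n)/(d·2^n) = 0. -/
open Filter Topology

/-- The point `c * 2 ^ n` of the half-line, for `c ≥ 1`. -/
def pt (c : ℝ) (hc : 1 ≤ c) (n : ℕ) : Hl :=
  ⟨c * 2 ^ n, Set.mem_Ici.mpr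
    (le_trans hc (le_mul_of_one_le_right (le_trans zero_le_one hc)
      (one_le_pow₀ one_le_two)))⟩

/-- For distinct `m, n`, the points `c * 2 ^ m` and `d * 2 ^ n` are separated proportionally
to `c * 2 ^ m`. -/
lemma le_mul_dist_pt (c d : ℝ) (hc1 : 1 ≤ c) (hd1 : 1 ≤ d) (hc2 : c < 2) (hd2 : d < 2)
    (hcd : c ≤ d) {m n : ℕ} (hmn : m ≠ n) :
    c * 2 ^ m ≤ 4 / (2 - d) * dist (pt c hc1 m) (pt d hd1 n) := by
  have hd : 0 < 2 - d := by linarith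
  rw [div_mul_eq_mul_div, le_div_iff₀ hd]
  change c * 2 ^ m * (2 - d) ≤ 4 * |c * 2 ^ m - d * 2 ^ n|
  have hm : (0 : ℝ) < 2 ^ m := by positivity
  rcases lt_or_gt_of_ne hmn with h | h
  · have hp : (2 : ℝ) ^ (m + 1) ≤ 2 ^ n := pow_le_pow_right₀ one_le_two h
    rw [pow_succ] at hp
    have h1 := mul_le_mul_of_nonneg_left hp (zero_le_one.trans hd1)
    have h2 := mul_le_mul_of_nonneg_right hcd hm.le
    have h3 := neg_le_abs (c * 2 ^ m - d * 2 ^ n)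
    have h4 : 0 < c * 2 ^ m := by positivity
    nlinarith
  · have hp : (2 : ℝ) ^ (n + 1) ≤ 2 ^ m := pow_le_pow_right₀ one_le_two h
    rw [pow_succ] at hp
    have h1 := mul_le_mul_of_nonneg_left hp (zero_le_one.trans hd1)
    have h2 := le_abs_self (c * 2 ^ m - d * 2 ^ n)
    have h3 : c * ((2 - d) * 2 ^ m) ≤ 2 * ((2 - d) * 2 ^ m) :=
      mul_le_mul_of_nonneg_right hc2.le (by positivity)
    have h4 := mul_le_mul_of_nonneg_right hc1 hm.le
    linarith

/-- Injectivity of the parametrization off the boundary: if `1 ≤ c ≤ d < 2` and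
`𝒰 ≠ 𝒱` are distinct free ultrafilters on the nonnegative integers, then some
Lipschitz (hence uniformly continuous) function `f` on the half-line satisfies
`lim_{𝒰(n)} f(c·2^n)/(c·2^n) = 1` and `lim_{𝒱(n)} f(d·2^n)/(d·2^n) = 0`. -/
theorem parametrization_injective (c d : ℝ) (hc1 : 1 ≤ c) (hd1 : 1 ≤ d)
    (hc2 : c < 2) (hd2 : d < 2) (hcd : c ≤ d)
    (𝒰 𝒱 : Ultrafilter ℕ) (h𝒰 : ∀ n : ℕ, 𝒰 ≠ pure n) (h𝒱 : ∀ n : ℕ, 𝒱 ≠ pure n)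
    (hne : 𝒰 ≠ 𝒱) :
    ∃ f : Hl → ℝ, (∃ L : NNReal, LipschitzWith L f) ∧
      Tendsto (fun n : ℕ => f (pt c hc1 n) / (c * 2 ^ n)) ↑𝒰 (𝓝 1) ∧
      Tendsto (fun n : ℕ => f (pt d hd1 n) / (d * 2 ^ n)) ↑𝒱 (𝓝 0) := by
  obtain ⟨A, hAU, hAV⟩ : ∃ A ∈ 𝒰, A ∉ 𝒱 := by
    by_contra! h
    exact hne (Ultrafilter.coe_le_coe.mp fun A hA => h A hA).symm
  have hAV' : Aᶜ ∈ 𝒱 := Ultrafilter.compl_mem_iff_notMem.mpr hAV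
  set D : Set Hl := pt d hd1 '' Aᶜ
  have hDne : D.Nonempty := (Ultrafilter.nonempty_of_mem hAV').image _
  refine ⟨fun x => min (x : ℝ) (4 / (2 - d) * Metric.infDist x D),
    ⟨max 1 (‖4 / (2 - d)‖₊ * 1), ?_⟩, ?_, ?_⟩
  · exact LipschitzWith.min (LipschitzWith.subtype_val _)
      ((lipschitzWith_smul (4 / (2 - d))).comp (Metric.lipschitz_infDist_pt D))
  · refine tendsto_const_nhds.congr' ?_
    filter_upwards [hAU] with m hm
    have hle : c * 2 ^ m ≤ 4 / (2 - d) * Metric.infDist (pt c hc1 m) D := by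
      have hpos : 0 < 4 / (2 - d) := div_pos (by norm_num) (by linarith)
      rw [← div_le_iff₀' hpos, Metric.le_infDist hDne]
      rintro _ ⟨n, hn, rfl⟩
      rw [div_le_iff₀' hpos]
      exact le_mul_dist_pt c d hc1 hd1 hc2 hd2 hcd (fun h => hn (h ▸ hm))
    have hne0 : c * 2 ^ m ≠ 0 := by positivity
    change 1 = min (c * 2 ^ m) _ / (c * 2 ^ m)
    rw [min_eq_left hle, div_self hne0]
  · refine tendsto_const_nhds.congr' ?_
    filter_upwards [hAV'] with n hn
    have h0 : Metric.infDist (pt d hd1 n) D = 0 :=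
      Metric.infDist_zero_of_mem (Set.mem_image_of_mem _ hn)
    change 0 = min (d * 2 ^ n) _ / (d * 2 ^ n)
    rw [h0, mul_zero, min_eq_right (by positivity), zero_div]
end

section
/- Homomorphisms on Lip(ℕ): let φ : Lip(ℕ) → ℝ be a vector-lattice homomorphism with φ(𝔱) = 1, where 𝔱 is the inclusion map n ↦ n. If φ(𝟏) > 0, then there exists a positive integer n such that φ(f) = f(n)/n for every f ∈ Lip(ℕ). -/
open Filter Topology

/-- A function on the positive integers is Lipschitz for the metric inherited
from `ℝ`. -/
def LipOnPNat (f : ℕ+ → ℝ) : Prop :=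
  ∃ L : ℝ, ∀ m n : ℕ+, |f m - f n| ≤ L * |((m : ℕ) : ℝ) - ((n : ℕ) : ℝ)|

/-- `φ` is a vector-lattice homomorphism on the lattice `Lip(ℕ)` of Lipschitz
real-valued functions on the positive integers, with pointwise operations and
order. -/
def IsLatticeHomLip (φ : (ℕ+ → ℝ) → ℝ) : Prop :=
  (∀ f g : ℕ+ → ℝ, LipOnPNat f → LipOnPNat g → φ (f + g) = φ f + φ g) ∧
  (∀ (c : ℝ) (f : ℕ+ → ℝ), LipOnPNat f → φ (c • f) = c * φ f) ∧
  (∀ f g : ℕ+ → ℝ, LipOnPNat f → LipOnPNat g → φ (f ⊔ g) = max (φ f) (φ g))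

namespace LipOnPNat

theorem const (c : ℝ) : LipOnPNat (fun _ => c) := ⟨0, by simp⟩

theorem coe : LipOnPNat (fun n : ℕ+ => ((n : ℕ) : ℝ)) := ⟨1, by simp⟩

theorem add {f g : ℕ+ → ℝ} (hf : LipOnPNat f) (hg : LipOnPNat g) : LipOnPNat (f + g) := by
  obtain ⟨K, hK⟩ := hf
  obtain ⟨L, hL⟩ := hg
  refine ⟨K + L, fun m n => ?_⟩
  calc |(f + g) m - (f + g) n| = |(f m - f n) + (g m - g n)| := by
        simp only [Pi.add_apply]; congr 1; ring
    _ ≤ |f m - f n| + |g m - g n| := abs_add_le _ _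
    _ ≤ (K + L) * |((m : ℕ) : ℝ) - ((n : ℕ) : ℝ)| := by linarith [hK m n, hL m n]

theorem smul {f : ℕ+ → ℝ} (c : ℝ) (hf : LipOnPNat f) : LipOnPNat (c • f) := by
  obtain ⟨K, hK⟩ := hf
  refine ⟨|c| * K, fun m n => ?_⟩
  simp only [Pi.smul_apply, smul_eq_mul]
  rw [← mul_sub, abs_mul, mul_assoc]
  exact mul_le_mul_of_nonneg_left (hK m n) (abs_nonneg c)

theorem abs {f : ℕ+ → ℝ} (hf : LipOnPNat f) : LipOnPNat |f| := by
  obtain ⟨K, hK⟩ := hf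
  exact ⟨K, fun m n => (abs_abs_sub_abs_le_abs_sub (f m) (f n)).trans (hK m n)⟩

end LipOnPNat

namespace IsLatticeHomLip

variable {φ : (ℕ+ → ℝ) → ℝ}

theorem map_abs (hφ : IsLatticeHomLip φ) {f : ℕ+ → ℝ} (hf : LipOnPNat f) : φ |f| = |φ f| := by
  have h := hφ.2.2 f ((-1 : ℝ) • f) hf (hf.smul _)
  rw [hφ.2.1 _ _ hf, neg_one_smul, neg_one_mul] at h
  exact h

theorem mono (hφ : IsLatticeHomLip φ) {f g : ℕ+ → ℝ} (hf : LipOnPNat f) (hg : LipOnPNat g)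
    (hfg : f ≤ g) : φ f ≤ φ g := by
  have h := hφ.2.2 f g hf hg
  rw [sup_eq_right.mpr hfg] at h
  exact h ▸ le_max_left _ _

theorem map_add_smul_one (hφ : IsLatticeHomLip φ) {f : ℕ+ → ℝ} (hf : LipOnPNat f) (c : ℝ) :
    φ (f + c • fun _ => (1 : ℝ)) = φ f + c * φ (fun _ => (1 : ℝ)) := by
  rw [hφ.1 _ _ hf ((LipOnPNat.const 1).smul c), hφ.2.1 _ _ (LipOnPNat.const 1)]

end IsLatticeHomLip

/-- Homomorphisms on `Lip(ℕ)`: if `φ : Lip(ℕ) → ℝ` is a vector-lattice homomorphism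
with `φ(𝔱) = 1` (where `𝔱 : n ↦ n`) and `φ(𝟏) > 0`, then `φ` is a normalized
evaluation: there is a positive integer `n` with `φ(f) = f(n)/n` for every
`f ∈ Lip(ℕ)`. -/
theorem lip_nat_hom_evaluation (φ : (ℕ+ → ℝ) → ℝ) (hφ : IsLatticeHomLip φ)
    (ht : φ (fun n : ℕ+ => ((n : ℕ) : ℝ)) = 1) (h1 : 0 < φ (fun _ => (1 : ℝ))) :
    ∃ n : ℕ+, ∀ f : ℕ+ → ℝ, LipOnPNat f → φ f = f n / ((n : ℕ) : ℝ) := by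
  set c := φ (fun _ => (1 : ℝ)) with hc
  -- The distance function to `c⁻¹` lies in the kernel of `φ`.
  have hlin := LipOnPNat.coe.add ((LipOnPNat.const 1).smul (-c⁻¹))
  have hker : φ |(fun n : ℕ+ => ((n : ℕ) : ℝ)) + (-c⁻¹) • fun _ => (1 : ℝ)| = 0 := by
    rw [hφ.map_abs hlin, hφ.map_add_smul_one LipOnPNat.coe, ht, ← hc]
    simp [h1.ne']
  have hround : c⁻¹ = round c⁻¹ := by
    by_contra hne
    have hδ : 0 < |c⁻¹ - round c⁻¹| := abs_pos.mpr (sub_ne_zero.mpr hne)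
    have hle := hφ.mono ((LipOnPNat.const 1).smul |c⁻¹ - round c⁻¹|) hlin.abs fun m => by
      have h := round_le c⁻¹ ((m : ℕ) : ℤ)
      rw [abs_sub_comm c⁻¹ (((m : ℕ) : ℤ) : ℝ)] at h
      simpa [sub_eq_add_neg] using h
    rw [hker, hφ.2.1 _ _ (LipOnPNat.const 1), ← hc] at hle
    exact (mul_pos hδ h1).not_ge hle
  have hpos : 0 < round c⁻¹ := by
    have h := inv_pos.mpr h1
    rw [hround] at h
    exact_mod_cast h
  obtain ⟨n, hn⟩ := Int.eq_ofNat_of_zero_le hpos.le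
  have hn0 : 0 < n := by omega
  rw [hn, Int.cast_natCast] at hround
  refine ⟨⟨n, hn0⟩, fun f hf => ?_⟩
  have hsub := hf.add ((LipOnPNat.const 1).smul (-f ⟨n, hn0⟩))
  obtain ⟨L, hL⟩ := hf
  have hle := hφ.mono hsub.abs (hlin.abs.smul L) fun m => by
    simpa [hround, sub_eq_add_neg] using hL m ⟨n, hn0⟩
  rw [hφ.2.1 _ _ hlin.abs, hker, mul_zero, hφ.map_abs hsub,
    hφ.map_add_smul_one ⟨L, hL⟩, ← hc] at hle
  have h0 := abs_nonpos_iff.mp hle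
  rw [PNat.mk_coe, ← hround, div_inv_eq_mul]
  linarith
end
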